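/- There is no party-approval rule for 6 voters, 4 parties, and committee size 3 that simultaneously satisfies anonymity, weak representation, and strategyproofness. -/

import Mathlib

/-- An approval profile is valid if every voter's ballot is nonempty. -/
def ValidProfile {P : Type*} (n : ℕ) (A : Fin n → Finset P) : Prop :=
  ∀ i, (A i).Nonempty

/-- The number of seats a committee `W` assigns to the parties in `X`. -/
def seats {P : Type*} [DecidableEq P] (W : Multiset P) (X : Finset P) : ℕ :=
  ∑ x ∈ X, W.count x

/-- A party-approval rule for `n` voters and committee size `k`:
it assigns to every (valid) approval profile a committee of size `k`. -/
def IsPAPPRule {P : Type*} (n k : ℕ) (f : (Fin n → Finset P) → Multiset P) : Prop :=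
  ∀ A, ValidProfile n A → Multiset.card (f A) = k

/-- Anonymity: permuting the voters does not change the outcome. -/
def Anonymous {P : Type*} (n : ℕ) (f : (Fin n → Finset P) → Multiset P) : Prop :=
  ∀ A, ValidProfile n A → ∀ π : Equiv.Perm (Fin n), f (fun i => A (π i)) = f A

/-- Weak representation: a party uniquely approved by at least `n / k` voters
gets at least one seat. -/
def WeakRep {P : Type*} [DecidableEq P] (n k : ℕ)
    (f : (Fin n → Finset P) → Multiset P) : Prop :=
  ∀ A, ValidProfile n A → ∀ (x : P) (G : Finset (Fin n)),
    n ≤ k * G.card → (∀ i ∈ G, A i = {x}) → 1 ≤ (f A).count x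

/-- Weak proportional representation: a party uniquely approved by at least
`ℓ * n / k` voters gets at least `ℓ` seats. -/
def WeakPropRep {P : Type*} [DecidableEq P] (n k : ℕ)
    (f : (Fin n → Finset P) → Multiset P) : Prop :=
  ∀ A, ValidProfile n A → ∀ (x : P) (G : Finset (Fin n)) (ℓ : ℕ),
    1 ≤ ℓ → ℓ * n ≤ k * G.card → (∀ i ∈ G, A i = {x}) → ℓ ≤ (f A).count x

/-- Strategyproofness: no voter can increase the number of seats assigned to
her approved parties by misreporting her ballot. -/
def Strategyproof {P : Type*} [DecidableEq P] (n : ℕ)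
    (f : (Fin n → Finset P) → Multiset P) : Prop :=
  ∀ A A' : Fin n → Finset P, ValidProfile n A → ValidProfile n A' →
    ∀ i : Fin n, (∀ j, j ≠ i → A j = A' j) →
      seats (f A') (A i) ≤ seats (f A) (A i)

/-! ### Encoding of profiles and committees -/

/-- The `i`-th hexadecimal digit of `n`. -/
def nibble (n i : ℕ) : ℕ := n / 16 ^ i % 16

/-- The set of parties encoded by the binary digits of `b`, where `0` stands for all parties. -/
def ballot (b : ℕ) : Finset (Fin 4) :=
  if b = 0 then Finset.univ else Finset.univ.filter fun x => b.testBit x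

/-- The profile encoded by the first six hexadecimal digits of `key`. -/
def profileOf (key : ℕ) : Fin 6 → Finset (Fin 4) := fun i => ballot (nibble key i)

/-- The digits of a key, from the least significant one. -/
def digits (key : ℕ) : List ℕ :=
  [nibble key 0, nibble key 1, nibble key 2, nibble key 3, nibble key 4, nibble key 5]

/-- The number whose hexadecimal digits are given by a list. -/
def pack : List ℕ → ℕ
  | [] => 0
  | d :: l => d + 16 * pack l

/-- The key with the given digits, arranged in increasing order. -/
def sortedKey (l : List ℕ) : ℕ := pack (l.insertionSort (· ≤ ·))

/-- The number of seats of party `x` in the `w`-th of the twenty committees of size three. -/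
def committeeCount (w : ℕ) (x : Fin 4) : ℕ :=
  nibble
    400501770656839959329509554580377018660488370442783685176766211537998904500960812597127607877635
    (4 * w + x)

/-- The number of seats of the ballot `b` in the `w`-th committee. -/
def committeeSeats (w b : ℕ) : ℕ := ∑ x ∈ ballot b, committeeCount w x

/-- The set of all twenty committees, as a bit mask. -/
def fullMask : ℕ := 1048575

/-- The set of committees giving at least `j` seats to the ballot `b`, as a bit mask. -/
def thresholdMask (b j : ℕ) : ℕ :=
  20815864389328798163850480637929670319827186139225083379120204017283186996764498447811551167099534074310580113805891786231399226551535235223016950284791214840804504791728325527722341882331874168850857018351936517008980320292671785014474614353838881114393673514409050039132745258857546628912189953715706740636081857179762279105655397753224105845218395244715008010769464828462592138674175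
    / 2 ^ (20 * (4 * b + j)) % 2 ^ 20

/-- The actions of the permutations of the parties on ballots, as lists of hexadecimal digits. -/
def relabelings : List ℕ :=
  [18364758544493064720, 18364683486789906960, 18355225778678027280, 18355113192123290640,
    18336085189344794640, 18336047660493215760, 18297203519274627360, 18297128461571469600,
    18282904370552071200, 18282773019571545120, 18263763781218838560, 18263707487941470240,
    18152560703022715200, 18152448116467978560, 18147794320115196480, 18147662969134670400,
    18119083436115347520, 18119064671689558080, 17863200012815733120, 17863162483964154240,
    17858433629908214400, 17858377336630846080, 17848863335241598080, 17848844570815808640]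

/-! ### The certificate checker -/

/-- Evaluate a numeral before passing it on. -/
def force {α : Type*} : ℕ → (ℕ → α) → α
  | 0, k => k 0
  | n + 1, k => k (n + 1)

/-- The committees compatible with weak representation at a profile. -/
def representationMask (key : ℕ) : ℕ :=
  [1, 2, 4, 8].foldr
    (fun x m => bif Nat.ble 2 ((digits key).countP fun d => Nat.beq d x) then
      thresholdMask x 1 &&& m else m) fullMask

/-- The committees still possible at a profile, given a list of masks for some profiles. -/
def lookup (key : ℕ) : List (ℕ × ℕ) → ℕ
  | [] => representationMask key
  | (k, m) :: env => bif Nat.beq k key then m else lookup key env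

/-- The profile of an encoded seat bound. -/
def boundKey (l : ℕ) : ℕ := l % 16 ^ 6

/-- The ballot of an encoded seat bound. -/
def boundBallot (l : ℕ) : ℕ := l / 16 ^ 6 % 16

/-- The number of seats required by an encoded seat bound. -/
def boundSeats (l : ℕ) : ℕ := l / 16 ^ 7 % 4

/-- The committees satisfying an encoded seat bound. -/
def boundMask (l : ℕ) : ℕ := thresholdMask (boundBallot l) (boundSeats l)

/-- The image of a seat bound under a permutation of the parties. -/
def relabel (r l : ℕ) : ℕ :=
  sortedKey ((digits (boundKey l)).map (nibble r)) +
    16 ^ 6 * (nibble r (boundBallot l) + 16 * boundSeats l)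

/-- The committees at a profile with ballot `b` that strategyproofness leaves possible if the
committee is in `m` after this ballot is changed to or from `a`. -/
def moveMask (a b m : ℕ) : ℕ :=
  [1, 2, 3].foldr
    (fun j acc =>
      (bif Nat.beq (m &&& thresholdMask b j) m then thresholdMask b j else fullMask) &&&
        ((bif Nat.beq (m &&& thresholdMask a j) 0 then fullMask ^^^ thresholdMask a j
          else fullMask) &&& acc)) fullMask

/-- Restrict the committees at a profile to a mask. The check succeeds if none is left. -/
def restrict (key mask : ℕ) (env : List (ℕ × ℕ)) (cont : List (ℕ × ℕ) → Bool) : Bool :=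
  force key fun key => force (lookup key env &&& mask) fun m =>
    bif Nat.beq m 0 then true else cont ((key, m) :: env)

/-- Suppose that all seat bounds in a list fail. -/
def assumeFailure : List ℕ → List (ℕ × ℕ) → (List (ℕ × ℕ) → Bool) → Bool
  | [], env, cont => cont env
  | l :: ls, env, cont =>
    restrict (boundKey l) (fullMask ^^^ boundMask l) env fun env => assumeFailure ls env cont

/-- A propagation along the change of one ballot. -/
def moveStep (n : ℕ) (env : List (ℕ × ℕ)) (cont : List (ℕ × ℕ) → Bool) : Bool :=
  match env[n / 96]? with
  | none => false
  | some (key, m) =>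
    restrict (sortedKey ((digits key).set (n % 6) (n / 6 % 16)))
      (moveMask (nibble key (n % 6)) (n / 6 % 16) m) env cont

/-- A propagation by a relabeled copy of an earlier fact, all but one of whose seat bounds are
already refuted. -/
def citeStep (db : List (List ℕ)) (n : ℕ) (env : List (ℕ × ℕ))
    (cont : List (ℕ × ℕ) → Bool) : Bool :=
  match relabelings[n % 32]?, db[n / 2048]? with
  | some r, some C =>
    match C[n / 32 % 64]? with
    | none => false
    | some l =>
      ((C.eraseIdx (n / 32 % 64)).all fun l' => force (relabel r l') fun l' =>
        Nat.beq (lookup (boundKey l') env &&& boundMask l') 0) &&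
      force (relabel r l) fun l => restrict (boundKey l) (boundMask l) env cont
  | _, _ => false

/-- Carry out a list of propagations. -/
def propagate (db : List (List ℕ)) : List ℕ → List (ℕ × ℕ) → Bool
  | [], _ => false
  | n :: ns, env =>
    bif Nat.beq (n % 2) 0 then moveStep (n / 2) env (propagate db ns)
    else citeStep db (n / 2) env (propagate db ns)

/-- Check a list of facts, each a disjunction of seat bounds given with the propagations that
refute its negation, the last fact being the empty disjunction. -/
def checkCertificate : List (List ℕ × List ℕ) → List (List ℕ) → Bool
  | [], db => db.head?.any List.isEmpty
  | (C, ns) :: rest, db =>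
    assumeFailure C [] (propagate db ns) && checkCertificate rest (C :: db)

/-- The facts of the impossibility proof together with their propagations. -/
def certificate : List (List ℕ × List ℕ) :=
  [([428229137], []),
  ([429417505], [1, 110]),
  ([441721361], []),
  ([447037969], [1, 126]),
  ([378806801], []),
  ([378946065], [1, 78]),
  ([445915665], []),
  ([447300113], [1, 126]),
  ([449126929], []),
  ([449466897], [1, 126]),
  ([378872337], []),
  ([378950161], [1, 78]),
  ([450175505], []),
  ([450515473], [1, 126]),
  ([399153217, 665355585], [32807, 8231, 8237, 870, 1066, 254, 252, 250, 212]),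
  ([374481169], []),
  ([375726353], [1, 80]),
  ([441590033], []),
  ([447029521], [1, 128]),
  ([450502929], [1, 164]),
  ([313034017, 903378209, 682133329], [12325, 43, 854, 1120, 1316, 418, 160, 358, 30, 124, 104,
    88, 28, 232, 316, 298, 296, 490, 228, 230, 214, 226]),
  ([426140177], []),
  ([429286945], [1, 110]),
  ([434726433], [1, 176]),
  ([434664993, 697853473], [1, 43, 654, 850, 308, 300, 298, 210]),
  ([313034017, 316180257, 682133329], [32805, 20523, 928, 1124, 16449, 77, 162, 104, 88, 28,
    232, 316, 298, 296, 490, 228, 230, 214, 226]),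
  ([313034017, 682133329], [278, 65, 226, 262]),
  ([769283106, 581325857, 866468385], [86029, 94237, 790, 1018, 268, 326, 248, 15]),
  ([432620594, 616973089], [90137, 404, 680, 5, 4117]),
  ([591667729], []),
  ([591671841], [1, 38]),
  ([595862033], []),
  ([595866145], [1, 38]),
  ([430326289], []),
  ([430531617], [1, 110]),
  ([374546961], []),
  ([375730705], [1, 78]),
  ([509948433], [1]),
  ([513168161], [1, 110]),
  ([734745633, 903378242, 313021507, 332039490, 600462386, 332043586, 315262019, 315266115,
    902382625, 902317089], [32801, 24609, 143393, 143391, 118815, 16403, 143403, 143407, 118831,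
    110637, 45, 3300, 4086, 4244, 4448, 428, 680, 884, 848, 844, 98313, 804, 804, 402, 38,
    40961, 104, 298, 504, 698, 896, 888, 1082, 1110, 1064, 1258, 1216, 1218, 1258, 1216, 1066,
    972, 1212, 1256, 1256, 1300, 40983, 1448, 1642, 1548, 1876, 1876, 1874, 1768, 1356, 1360,
    73885, 1492, 1002, 916, 592, 808, 98305, 104, 20, 224, 254, 228, 320, 45195, 40967, 420,
    492, 496, 416, 422, 306, 346, 296, 320, 312]),
  ([917066818, 734745633, 902382625, 902317089], [147485, 122909, 896, 58, 108, 53327, 46, 298,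
    502, 534, 448, 61457, 680, 916, 1110, 532, 726, 804, 612, 420, 1]),
  ([430462018, 416838978, 581465410, 581456962], [64, 280, 65553, 298, 298]),
  ([426141201], []),
  ([429287009], [1, 110]),
  ([434726497], [1, 176]),
  ([334351393, 600621857], [7, 19, 728, 922, 230, 228, 226, 214]),
  ([902382625, 734745633], [172057, 155673, 172049, 172061, 172051, 147487, 131103, 172067,
    1590, 1748, 1952, 2240, 608, 812, 1064, 1268, 1402, 1424, 1402, 1612, 1594, 1612, 126985,
    844, 996, 77903, 634, 786, 1014, 610, 814, 1066, 1076, 998, 1078, 1006, 1314, 1304, 69633,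
    900, 920, 77857, 356, 278, 77851, 76, 56, 156, 14, 104, 6632, 6756, 20481, 550, 490, 704,
    898, 846, 1064, 69739, 1034, 1078, 16449, 628, 458, 402, 502, 526, 438, 544, 404, 492, 716,
    440, 460, 356, 220, 498, 492, 498, 502, 502, 518, 17, 544]),
  ([380134673, 379073041, 682197521], [143363, 65573, 880, 990, 220, 308, 226, 298, 234, 234]),
  ([734745633], [180249, 172057, 163865, 180241, 180253, 155677, 147485, 180243, 139295, 163875,
    1974, 2132, 2336, 2600, 2816, 2938, 4097, 1184, 1388, 1424, 1402, 1612, 1594, 1594, 1404,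
    1618, 1612, 135177, 1420, 1572, 86095, 876, 826, 978, 610, 874, 1078, 1184, 1460, 1268,
    1190, 1198, 1506, 1462, 1316, 1092, 920, 86049, 356, 278, 86043, 76, 56, 60, 348, 302, 206,
    298, 514, 718, 680, 598, 680, 77931, 548, 24641, 436, 210, 414, 502, 97, 630, 630, 500, 492,
    716, 716, 682, 652, 502, 544, 266, 220, 498, 450, 498, 502, 404, 518, 8209, 548, 250, 310,
    212]),
  ([430461985], [184349, 184339, 23, 25, 840, 1038, 1232, 1426, 548, 324, 262, 322, 248, 222,
    90191, 90209, 226, 250]),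
  ([434520593], []),
  ([434725921], [1, 110]),
  ([601654049, 317574177], [220, 534, 342, 346, 364, 24577]),
  ([334267425, 633898033], [200713, 4103, 118795, 916, 998, 230, 544, 490, 418, 1, 106565, 16,
    220, 368, 344, 106539, 358, 350]),
  ([430470177, 363431490], [20499, 466, 684, 103, 268, 314]),
  ([430334481], []),
  ([430532129], [1, 110]),
  ([432288273], []),
  ([432620321], [1, 110]),
  ([480859169, 585974561, 631849761, 631854130], [40965, 804, 1002, 1196, 404, 548, 356, 28,
    344, 560, 536, 538, 400, 556, 139271, 536, 212]),
  ([787169809, 347423249], [176129, 163847, 596, 826, 274, 260, 20, 214, 270, 272, 226, 248]),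
  ([631849761, 480859169], [36, 234, 428, 260, 444, 226, 4161, 250, 220, 370, 17]),
  ([329877057, 682198593], [45, 344]),
  ([430391825], []),
  ([430535713], [1, 110]),
  ([481837857, 650724129, 751387425], [53273, 45155, 920, 302, 308]),
  ([296244257, 300434209, 921191201, 971522577, 1021858849, 921195553], [57347, 1324, 1522, 244,
    210, 236, 230]),
  ([478626593, 969573665, 968381473, 969638945, 969639201, 1036534561, 867726369, 751330081],
    [131081, 8201, 4175, 2056, 246, 246, 450, 520, 534, 64, 33, 512, 706, 634, 448, 53339, 514,
    442, 398]),
  ([600408865, 478626593, 1036534561, 867726369, 751330081, 952801313], [77827, 57453, 1302,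
    306, 472, 112, 2140, 2368, 2584, 508, 244, 448, 450, 524, 442, 716, 129, 526]),
  ([1053311777, 478626593, 1036534561], [40963, 258085, 40975, 69669, 266283, 1188, 61549,
    61551, 1878, 708, 652, 892, 830, 1070, 1014, 65581, 24583, 24595, 612, 900, 1026, 1230,
    180253, 680, 206, 172113, 16, 221189, 1, 13, 296, 296]),
  ([1053311777, 969425713, 935871281, 415843105, 935871265, 1002980129], [270341, 308, 422, 212,
    208, 176223, 368]),
  ([364405793, 1034441761, 917001249], [57347, 77855, 192543, 1086, 1280, 1474, 510, 4245, 828,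
    898, 832, 828, 598, 640, 406, 246, 85]),
  ([364405793, 1034441761], [69699, 129, 210]),
  ([736777249, 300631073], [282653, 438, 634, 332, 370, 49181]),
  ([1037595681, 932733985, 1005089825, 999846945, 998798369], [874, 1078, 1330, 554, 458, 654,
    650, 7, 86089, 746, 650, 86053]),
  ([348668705, 933778465, 921203745, 300516385, 969638945], [299033, 102409, 102411, 102415,
    102421, 12299, 12321, 520, 20545, 12309, 442, 520, 404, 474, 278, 298, 514, 742, 13]),
  ([413684769, 411517985, 914834465, 680031265, 412644385, 865629217, 917009441, 866677793],
    [106497, 106525, 37093, 24645, 250, 246]),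
  ([348668705, 932733985, 985162785, 347628577, 616055841, 347619857, 986416161], [110595,
    110599, 110613, 20503, 149, 16427, 302, 310, 28745]),
  ([432284177], []),
  ([432620065], [1, 110]),
  ([600056337], []),
  ([600060449], [1, 38]),
  ([734278177], [1]),
  ([734741281], [1, 136]),
  ([601104913], []),
  ([601109025], [1, 38]),
  ([365585169], []),
  ([365585713], [1, 62]),
  ([865420065, 413754689, 613831713, 715740193, 648631329], [34, 988, 1276, 268, 266, 314]),
  ([434922001], []),
  ([434935329], [1, 110]),
  ([630740018, 480859169], [36, 236, 594, 896, 320, 212, 127041, 226, 220, 250, 122961, 370]),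
  ([434782737], []),
  ([434803745], [1, 110]),
  ([363414033], []),
  ([363418657], [1, 62]),
  ([600409138, 970691617, 617322049, 1020814369, 903373857, 999842849, 650810401, 999842866,
    983074386, 986286162, 667453234, 650806305, 346588449, 1020953633, 970621985, 647530306,
    648643617, 970490913, 1020822561, 1017742658, 698975554, 650740786, 647529794, 298489923,
    650741058, 952801346, 617186882, 298419779, 650741570], [249861, 385027, 376869, 249865,
    376873, 8217, 180263, 47, 352297, 352299, 249899, 360495, 151595, 192531, 192543, 16, 298,
    298, 6976, 1172, 5270, 28715, 256, 228, 298, 224, 208, 298, 16427, 139307, 844, 590, 854,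
    590, 830, 1046, 934, 400, 490, 448, 660, 682, 598, 934, 896, 652, 694, 638, 70, 166, 176169,
    176171, 208, 298, 538, 538, 424, 256, 344, 250, 274435, 278665, 470, 494, 500, 418, 466,
    167961, 498, 470, 270, 282637, 340, 536, 420, 728, 344, 244, 250, 318, 206, 272, 524, 550,
    518, 222, 220, 308, 358, 328]),
  ([313099841, 600409138, 667453234, 1017742658, 698975554, 650740786, 298489923, 952801346,
    985237058, 867796546, 698975812, 983074370, 1017676833, 631866945], [262165, 380973, 253985,
    253997, 372779, 348203, 340009, 380963, 299029, 3528, 3724, 212, 278559, 127023, 80, 296,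
    512, 2792, 2986, 3100, 3416, 3610, 20525, 143405, 1180, 286809, 804, 604, 882, 143457, 1024,
    988, 1204, 1504, 282711, 1754, 1484, 1378, 1216, 1460, 1682, 1860, 2078, 2276, 2240, 2250,
    2176, 2392, 2082, 1842, 1790, 1890, 1778, 1570, 208913, 602, 596, 736, 594, 688, 180317,
    180241, 22, 238, 502, 897, 350, 300, 242, 308]),
  ([313099841, 600409138, 698975554, 650740786, 298489923, 631866945], [385069, 258081, 385067,
    28701, 385059, 159787, 72, 268, 1258, 1492, 1690, 290905, 408, 420, 412, 628, 832, 339981,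
    524, 512, 486, 290857, 412, 340, 36907, 36, 250, 224, 104, 147499, 522, 506, 290897, 638,
    842, 874, 790, 628, 682, 910, 842, 648, 65]),
  ([665421377, 983065650, 1033397281, 999842849, 348751410, 647525409, 698897441, 983074386,
    1036682529, 986286162, 348816690, 667453234, 1034454305, 1016628257, 1017676833, 1034519585,
    598311969], [397315, 389157, 389141, 270357, 389161, 192551, 364585, 364587, 262187, 2716,
    2944, 356, 294951, 124, 5864, 5980, 220, 298, 256, 268, 232, 152, 286723, 290953, 444, 494,
    500, 398, 466, 180249, 442, 470, 278, 294925, 226, 228, 306, 344, 270, 250, 228]),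
  ([298489923, 665421377, 667453234, 600409138, 698975554], [393261, 393239, 385067, 393259,
    360491, 352297, 393251, 376879, 208915, 208927, 2602, 36, 299097, 28, 244, 448, 602, 682,
    348173, 1024, 1100, 1090, 796, 299049, 268, 340, 544, 5596, 5812, 298, 308, 188429, 460,
    296, 310, 164, 299053, 122, 326, 7560, 7756, 7892, 488, 430, 682, 290847, 610, 294999, 722,
    237639, 996, 1310, 1108, 1024, 1240, 1202, 1406, 1402, 1496, 213097, 1586, 1168, 1450, 1388,
    1228, 982, 980, 1066, 896, 790, 256, 7766, 45099, 256, 228, 298, 16, 4097, 608, 220, 418,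
    490, 155691, 844, 398, 662, 590, 854, 742, 298, 256, 468, 406, 742, 704, 502, 446, 70, 166,
    192555, 106, 346, 1]),
  ([364126737], []),
  ([364200481], [1, 62]),
  ([601109009], [73729, 42]),
  ([380969489], []),
  ([381047313], [1, 78]),
  ([508764689], []),
  ([518337041], [1, 174]),
  ([373432593], []),
  ([375660817], [1, 80]),
  ([361247265, 366641697, 682132257], [15, 380943, 380949, 1084, 1282, 220, 164, 32, 214, 310,
    230, 30, 226, 308, 300, 298, 210]),
  ([599147553, 653104161, 563500065, 1052132385], [438297, 102417, 12317, 214, 430, 694, 828,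
    1028, 728, 738, 598, 147, 728, 418, 494, 352263, 520, 498, 738, 690, 692, 352271, 354, 32,
    368, 268, 274]),
  ([1052132385, 563500065, 599147553], [442393, 36869, 32793, 24601, 106513, 16413, 65, 430,
    694, 828, 998, 1314, 1098, 1112, 348227, 982, 1126, 850, 920, 814, 946, 800, 822, 356359,
    838, 416, 620, 630, 754, 748, 646, 260, 362, 230]),
  ([598311986, 665421377, 983065650, 999842849, 1033397281, 698897441, 983074386, 1034454305,
    986286162, 667453234, 1016628257, 1017676833, 1034519585, 970490913, 650676034, 1036686386,
    1016629058, 1050182689, 365593650], [446501, 446509, 319511, 262163, 4138, 4252, 352345, 26,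
    3316, 241677, 104, 2176, 2276, 5966, 6230, 6486, 6680, 682, 682, 498, 19, 742, 598, 680,
    742, 660, 694, 652, 446, 53761, 262, 358, 358, 245867]),
  ([1034519585, 665421377, 999842849, 598311986, 983074386, 986286162, 667453234, 1017676833],
    [450605, 323617, 450583, 442411, 450603, 417835, 409641, 450595, 114723, 323619, 106531,
    266259, 266271, 2218, 2332, 228, 356441, 28, 244, 410, 490, 405517, 716, 910, 604, 356393,
    268, 352, 5596, 5812, 298, 245773, 268, 296, 310, 164, 356397, 122, 8078, 8282, 8534, 8794,
    538, 536, 682, 1258, 1404, 1620, 76, 344, 238, 490, 726, 680, 352343, 722, 922, 294983,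
    1188, 1502, 1064, 1180, 1432, 1662, 1586, 804, 1594, 1688, 1586, 1624, 1658, 1552, 1834,
    1764, 1772, 1608, 1364, 1510, 1414, 1450, 1360, 1280, 1256, 788, 53249, 934, 622, 396, 448,
    660, 724, 658, 704, 638, 692, 610, 454, 510, 358, 220, 249899, 449, 298]),
  ([432620594, 300237857, 576996129], [45081, 413723, 788, 274523, 362, 370, 218, 344]),
  ([598311986, 315197539, 665421377, 999842849, 983074386, 986286162, 667453234, 1017676833],
    [458797, 331809, 426027, 458787, 458799, 331811, 874, 36, 364633, 28, 244, 448, 413709, 524,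
    512, 364585, 148, 3508, 116, 5054, 5336, 5530, 4097, 74, 106, 340, 538, 530, 420, 420, 420,
    69761, 110635, 408, 456, 420, 442, 488, 416, 360535, 612, 604, 704, 680, 83, 490, 262, 254]),
  ([315114273, 1053311777, 650741281, 650740257, 348685873, 667453233, 583566113, 585925409,
    631800849, 568099617, 634029105], [454693, 335883, 430121, 1564, 417797, 2810, 3042, 298,
    494, 412, 398, 458, 556, 494, 307231, 266, 252, 364629, 684, 842, 490, 604, 844, 830, 1032,
    282731, 1036, 1084, 458, 632, 458, 418, 224, 368717, 225321, 413]),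
  ([478626593, 1053311777, 315114273, 347636753, 751321905], [466983, 270373, 385061, 1122,
    1572, 1766, 262253, 262255, 2454, 900, 918, 882, 1060, 1324, 1310, 1230, 266287, 1206, 748,
    266305, 520, 532, 296, 490, 704, 266253, 652, 372805, 782, 658, 322, 304, 513]),
  ([751321905, 1053311777, 315114273, 478626593], [230, 193, 208, 238, 298]),
  ([697848882, 617108530, 717771826], [163875, 682, 922, 346]),
  ([601670433, 317574177], [220, 538, 364, 307201]),
  ([505549073], []),
  ([518131985], [1, 178]),
  ([518856977], [1, 162]),
  ([514138385], [434177]),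
  ([518672657], [1, 174]),
  ([783975745, 350987281, 716875073, 631932225, 619349313], [503819, 8197, 1, 1366, 217185, 332,
    320, 62, 130, 138, 16, 176, 20, 250, 66, 18, 214, 368, 366, 320, 246]),
  ([631866945, 600409138, 635082818, 970627138, 648643906, 365598786, 983074370, 313099841],
    [507949, 380961, 380963, 298, 532, 413785, 228, 220, 409687, 462861, 232, 228, 454, 742,
    416, 400, 406, 270379, 228]),
  ([631866945, 983074370, 600409122, 635082818, 600409138, 648643906, 970627138, 313099841],
    [512045, 321, 490, 224, 417881, 266, 413719]),
  ([428294673], []),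
  ([429421601], [1, 110]),
  ([617112865, 969429793, 717771553, 600339745, 902329633, 717776161, 600335649, 583558433],
    [90, 45153, 234]),
  ([348668705, 650810401, 581526561, 999842849, 413692961, 899183649, 697853250, 617121569,
    648643617, 713585953, 898061345, 719868961, 983074386, 647530066, 899183938, 986481441,
    714626098, 647517234, 986219297, 986219826, 600343858, 716723250, 583697458, 903365409,
    970474273, 986215201, 298550322], [4139, 159749, 520229, 528425, 536601, 401445, 331813,
    528427, 503849, 495657, 159791, 344067, 339977, 339981, 339989, 249901, 324, 450, 666, 918,
    249883, 245791, 258115, 1702, 1472, 1264, 454, 718, 680, 252, 256, 434257, 406, 398, 686,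
    880, 1076, 976, 1068, 590, 830, 692, 886, 1112, 1316, 1166, 1430, 1684, 168009, 1786, 2070,
    2002, 53487, 1840, 1684, 1880, 1806, 1834, 1936, 2082, 1550, 1816, 1796, 1786, 1168, 1430,
    1432, 327745, 1054, 1306, 1036, 982, 1012, 1216, 1208, 1300, 1012, 1114, 1086, 1064, 1076,
    896, 822, 664, 562, 492, 692, 634, 290915, 290905, 750, 270377, 592, 152, 320, 558, 49189,
    342, 223, 560]),
  ([932733985, 348668705, 999842849, 749229106, 600540193], [532495, 405505, 532517, 405513,
    532501, 540685, 540697, 221207, 532523, 335903, 204803, 450599, 450605, 348175, 344065,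
    344071, 344075, 344079, 344093, 2436, 2632, 2766, 249865, 488, 88, 253975, 253987, 2260,
    512, 706, 254027, 996, 640, 856, 327769, 327771, 57365, 278679, 1596, 1620, 1816, 2010,
    2228, 253967, 253989, 262213, 2940, 3136, 3442, 3532, 3584, 3304, 3340, 3620, 3606, 3734,
    3682, 3754, 3958, 4174, 53253, 4342, 430083, 2036, 1742, 1958, 1982, 2218, 331861, 2466,
    2318, 430111, 1450, 1650, 1846, 1832, 1894, 1886, 438283, 1612, 1816, 1024, 438353, 331817,
    331819, 49193, 1420, 1624, 1168, 1180, 1408, 1360, 1606, 1846, 24623, 1450, 1316, 1066,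
    1044, 1042, 982, 1222, 1450, 1690, 1654, 438311, 1600, 1570, 1238, 1004, 1186, 1426, 1228,
    1432, 1660, 1582, 1650, 1570, 1460, 1450, 1654, 1648, 1496, 1074, 1036, 1068, 278565, 16419,
    236, 268, 129, 244]),
  ([718964001, 316175649], [224, 454, 280, 450573]),
  ([933778465, 921203745, 1004041249, 1000895521, 998798369, 300516385, 1021936673], [352271,
    262177, 249869, 212, 210]),
  ([1034441761, 747000882, 998654753, 749229106, 753419041, 921191201, 933778465, 1000887329],
    [417823, 262173, 420, 274, 274, 252]),
  ([329811265, 331974721, 617121089], [438305, 516135, 914, 1114, 242, 208, 308, 302]),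
  ([667453234, 362317378], [552983, 553003, 143407, 512045, 896, 1092, 26, 152, 1756, 1972, 268,
    326, 358, 320, 153, 34, 308, 352, 226, 308, 458797]),
  ([428303393, 650740786, 969644098, 600409633, 933778465, 652837921, 1021936673, 1034441761,
    1000887329, 582583874, 700024386, 714630466], [557103, 360491, 1068, 352357, 303263, 3180,
    510, 510, 726, 714, 488, 8331, 532, 462941, 460, 41029, 69]),
  ([932733985, 350848545, 600474913, 631866657, 1053393953, 716723233, 635077665, 999846945,
    347619857, 1051296801, 1053533217, 1000887329, 1034441761, 986425409, 1050174497, 565871937,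
    716866881, 1052271649, 348668705, 986416161], [434185, 434197, 569369, 36901, 192537,
    192541, 376835, 376843, 376855, 376869, 372745, 372757, 136, 278571, 290883, 634, 278537,
    1068, 1274, 1266, 976, 1096, 5642, 262185, 282647, 282659, 290889, 258241, 13, 1050, 1268,
    1492, 24841, 1606, 1854, 1846, 2074, 1940, 1980, 2176, 2226, 475151, 1758, 2046, 1844, 1878,
    1598, 1558, 1492, 1268, 1216, 1420, 1034, 1228, 1012, 1096, 886, 802, 874, 832, 922, 724,
    730, 323685, 894, 896, 436, 256, 460, 460, 490, 306, 356, 298, 346, 370, 272, 346, 304]),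
  ([412640289, 317555745, 935871265, 749229106, 631792962, 998654753, 719868961, 631796769,
    297371202, 300434465, 1000891425, 1005225009, 1051218977, 933778465, 988431137, 999842849,
    619336737, 720000033, 1005159457, 988300065, 347624481, 988513313, 899183649], [376841,
    376845, 270431, 481, 295009, 366, 368]),
  ([749229089, 748184626, 652837921, 699950113, 300450849, 937976881, 1050174497, 999842849,
    921199393, 933778465, 686392865, 652838433, 937972769, 921191201, 412644385, 921203745,
    631796769, 698905633, 917009441, 938181665, 937968145], [577539, 385043, 380937, 380941,
    290829, 286745, 274479, 278559, 274539, 286751, 42, 270, 444, 684, 259, 268]),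
  ([600540193, 348668705, 999842849, 898057249, 899183649, 749229106], [581633, 385033, 385037,
    385039, 385041, 385045, 294939, 294951, 290847, 634, 874, 1138, 472, 472, 36865, 90, 274701,
    294925, 303185, 806, 874, 834, 750, 562, 37005, 234, 334, 303189, 520, 438, 560, 366]),
  ([600540193, 348668705, 999842849, 749229106], [585729, 585731, 389129, 389133, 389135,
    389137, 389141, 299035, 299047, 294943, 634, 874, 1138, 472, 472, 40961, 90, 299021, 307281,
    299011, 806, 438, 750, 278529, 141, 142, 299023, 307285, 438, 490, 560, 558, 562, 236, 234]),
  ([650667297, 933782561, 867722273, 699950113, 700998433, 933778465, 313021473, 1053394465,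
    919106337, 600474913, 1022133537, 1036547361, 1036538657], [454665, 213001, 454677, 454693,
    385061, 213029, 3498, 3738, 3966, 4206, 102491, 858, 890, 470, 898, 654, 436, 344101, 322,
    268, 106729, 236, 272, 344085, 322, 250]),
  ([348668705, 581461041, 412640289, 752370465, 1000887329, 867713553, 933778465, 411517985,
    1036534561, 865629217, 867726369, 867718177, 751321905, 631796769, 1001935905], [593921,
    593945, 503817, 503833, 503855, 401419, 397321, 397323, 397325, 397337, 303129, 230, 307207,
    315473, 838, 1034, 1294, 1510, 1714, 1134, 1094, 942, 666, 414, 307219, 303151, 303147, 622,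
    4168, 49421, 307221, 303113, 4916, 5114, 804, 998, 1210, 1414, 1714, 862, 45137, 1054,
    45125, 1238, 1434, 886, 45077, 886, 1090, 45065, 299047, 1258, 1474, 1702, 1358, 810, 1038,
    41281, 1138, 12325, 1038, 1100, 898, 842, 1098, 1034, 1274, 1506, 8213, 1450, 1226, 1274,
    4115, 890, 978, 1036, 892, 842, 1066, 385113, 45157, 1288, 1262, 385097, 45155, 1322,
    385029, 1234, 299041, 385061, 1002, 299015, 622, 898, 466, 706, 554, 468, 242, 214, 236,
    258, 510, 536, 510, 37, 35, 5]),
  ([348668705, 1036534561, 412640289, 933778465, 631796769, 1001935905], [598017, 598041,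
    405515, 401417, 401419, 401421, 401433, 311299, 230, 454, 718, 326, 30, 307231, 307243, 270,
    706, 2632, 53517, 311323, 319553, 319555, 3494, 3706, 4006, 4148, 1380, 1574, 1786, 1990,
    1864, 1744, 1624, 65, 1438, 49233, 1630, 49221, 1814, 2010, 1178, 1078, 49173, 1078, 49161,
    303143, 1258, 1474, 1702, 1678, 1358, 311361, 16485]),
  ([313021473, 902329377, 1036534561, 1002980129, 412640289, 933786657], [405511, 405515,
    405517, 405519, 405529, 90, 315399, 323665, 682, 222, 282, 315407, 1570, 1906, 284, 147,
    294981]),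
  ([1053311777, 1036534561, 1002980129, 412640289], [606209, 409611, 409613, 409625, 90, 319501,
    319491, 319495, 327761, 982, 1258, 558, 476, 474, 315423, 319505, 319515, 303147, 327745,
    3928, 295107, 874, 319507, 904, 340015, 303145, 1]),
  ([1002980129, 412640289, 1036534561], [610305, 413709, 413711, 413721, 90, 323587, 323625,
    612, 331857, 209, 221, 1450, 1678, 1894, 1134, 323617, 323605, 1134, 227, 331875, 1806,
    65823, 476, 266, 460, 682, 898, 754, 61539, 946, 61527, 1132, 1330, 810, 61465, 810, 61453,
    315395, 978, 1218, 1482, 1666, 1372, 28673, 8365]),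
  ([412640289], [614401, 614403, 417805, 417817, 90, 323609, 101, 335953, 103, 129, 558, 133,
    311343]),
  ([478626593], [7, 19, 340033]),
  ([481850401], [1, 136]),
  ([382436385], [430087, 8193, 339991]),
  ([1002980129], [12295, 12307, 12313]),
  ([1003193377], [1, 136]),
  ([], [20481, 12289, 8217, 4101, 1, 336089])]

theorem checkCertificate_certificate : checkCertificate certificate [] = true := by
  decide +kernel

/-! ### Soundness of the checker -/

theorem force_eq {α : Type*} (n : ℕ) (k : ℕ → α) : force n k = k n := by
  cases n <;> rfl

theorem nibble_lt (n i : ℕ) : nibble n i < 16 := Nat.mod_lt _ (by norm_num)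

theorem ballot_nonempty : ∀ b < 16, (ballot b).Nonempty := by decide +kernel

theorem validProfile_profileOf (key : ℕ) : ValidProfile 6 (profileOf key) :=
  fun _ => ballot_nonempty _ (nibble_lt _ _)

theorem testBit_thresholdMask : ∀ b < 16, ∀ j < 4, ∀ w < 20,
    (thresholdMask b j).testBit w = decide (j ≤ committeeSeats w b) := by
  decide +kernel

theorem exists_perm_of_mem_relabelings : ∀ r ∈ relabelings, ∃ σ : Equiv.Perm (Fin 4),
    ∀ b < 16, ballot (nibble r b) = (ballot b).map σ.toEmbedding := by
  decide +kernel

theorem testBit_fullMask : ∀ w < 20, fullMask.testBit w = true := by decide +kernel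

theorem exists_committeeCount_eq (W : Multiset (Fin 4)) (hW : W.card = 3) :
    ∃ w < 20, ∀ x, W.count x = committeeCount w x := by
  have key : ∀ c : Fin 4 → Fin 4, ∑ x, (c x : ℕ) = 3 → ∃ w : Fin 20,
      ∀ x, (c x : ℕ) = committeeCount w x := by decide +kernel
  have hsum : ∑ x, W.count x = 3 :=
    ((Finset.sum_subset (Finset.subset_univ W.toFinset) (by simp)).symm.trans
      (Multiset.toFinset_sum_count_eq W)).trans hW
  obtain ⟨w, hw⟩ := key (fun x => ⟨W.count x,
    Nat.lt_succ_of_le ((Multiset.count_le_card x W).trans hW.le)⟩) hsum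
  exact ⟨w, w.isLt, hw⟩

/-- The rules excluded by the theorem. -/
def IsGoodRule (f : (Fin 6 → Finset (Fin 4)) → Multiset (Fin 4)) : Prop :=
  IsPAPPRule 6 3 f ∧ Anonymous 6 f ∧ WeakRep 6 3 f ∧ Strategyproof 6 f

/-- The rule obtained by renaming the parties. -/
def relabeledRule (σ : Equiv.Perm (Fin 4)) (f : (Fin 6 → Finset (Fin 4)) → Multiset (Fin 4)) :
    (Fin 6 → Finset (Fin 4)) → Multiset (Fin 4) :=
  fun A => (f fun i => (A i).map σ.toEmbedding).map σ.symm

theorem count_relabeledRule (σ : Equiv.Perm (Fin 4))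
    (f : (Fin 6 → Finset (Fin 4)) → Multiset (Fin 4)) (A : Fin 6 → Finset (Fin 4)) (x : Fin 4) :
    (relabeledRule σ f A).count x = (f fun i => (A i).map σ.toEmbedding).count (σ x) := by
  have h := Multiset.count_map_eq_count' σ.symm (f fun i => (A i).map σ.toEmbedding)
    σ.symm.injective (σ x)
  rwa [σ.symm_apply_apply] at h

theorem seats_relabeledRule (σ : Equiv.Perm (Fin 4))
    (f : (Fin 6 → Finset (Fin 4)) → Multiset (Fin 4)) (A : Fin 6 → Finset (Fin 4))
    (X : Finset (Fin 4)) :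
    seats (relabeledRule σ f A) X =
      seats (f fun i => (A i).map σ.toEmbedding) (X.map σ.toEmbedding) := by
  simp [seats, count_relabeledRule]

theorem validProfile_map {A : Fin 6 → Finset (Fin 4)} (hA : ValidProfile 6 A)
    (σ : Equiv.Perm (Fin 4)) : ValidProfile 6 fun i => (A i).map σ.toEmbedding :=
  fun i => (hA i).map

theorem IsGoodRule.relabeledRule {f : (Fin 6 → Finset (Fin 4)) → Multiset (Fin 4)}
    (hf : IsGoodRule f) (σ : Equiv.Perm (Fin 4)) : IsGoodRule (relabeledRule σ f) := by
  obtain ⟨hcard, hanon, hrep, hsp⟩ := hf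
  refine ⟨fun A hA => ?_, fun A hA π => ?_, fun A hA x G hG hx => ?_,
    fun A A' hA hA' i hi => ?_⟩
  · simpa [_root_.relabeledRule] using hcard _ (validProfile_map hA σ)
  · simp only [_root_.relabeledRule]
    rw [hanon _ (validProfile_map hA σ) π]
  · rw [count_relabeledRule]
    exact hrep _ (validProfile_map hA σ) _ G hG fun i hi => by simp [hx i hi]
  · rw [seats_relabeledRule, seats_relabeledRule]
    exact hsp _ _ (validProfile_map hA σ) (validProfile_map hA' σ) i fun j hj => by
      simp [hi j hj]

theorem exists_perm_of_ofFn_perm {n : ℕ} {a b : Fin n → ℕ}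
    (h : (List.ofFn a).Perm (List.ofFn b)) : ∃ π : Equiv.Perm (Fin n), ∀ i, a i = b (π i) := by
  have hs : a ∘ Tuple.sort a = b ∘ Tuple.sort b := by
    apply List.ofFn_injective
    refine List.Perm.eq_of_pairwise' (r := (· ≤ ·)) ?_ ?_ ?_
    · exact (Tuple.monotone_sort a).sortedLE_ofFn.pairwise
    · exact (Tuple.monotone_sort b).sortedLE_ofFn.pairwise
    · exact ((Tuple.sort a).ofFn_comp_perm a).trans (h.trans ((Tuple.sort b).ofFn_comp_perm b).symm)
  refine ⟨(Tuple.sort a).symm.trans (Tuple.sort b), fun i => ?_⟩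
  simpa using congrFun hs ((Tuple.sort a).symm i)

theorem Anonymous.apply_eq_of_perm {f : (Fin 6 → Finset (Fin 4)) → Multiset (Fin 4)}
    (hf : Anonymous 6 f) {a b : Fin 6 → ℕ} (hb : ∀ i, b i < 16)
    (h : (List.ofFn a).Perm (List.ofFn b)) :
    (f fun i => ballot (a i)) = f fun i => ballot (b i) := by
  obtain ⟨π, hπ⟩ := exists_perm_of_ofFn_perm h
  simp only [hπ]
  exact hf (fun i => ballot (b i)) (fun i => ballot_nonempty _ (hb i)) π

theorem digits_eq_ofFn (key : ℕ) : digits key = List.ofFn fun i : Fin 6 => nibble key i := by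
  simp [digits]

theorem digits_pack {l : List ℕ} (hl : l.length = 6) (h : ∀ d ∈ l, d < 16) :
    digits (pack l) = l := by
  match l, hl with
  | [a, b, c, d, e, g], _ =>
    simp only [List.mem_cons, List.not_mem_nil, or_false, forall_eq_or_imp, forall_eq] at h
    simp only [digits, nibble, pack, List.cons.injEq, and_true]
    lia

theorem profileOf_sortedKey_apply {f : (Fin 6 → Finset (Fin 4)) → Multiset (Fin 4)}
    (hf : Anonymous 6 f) {a : Fin 6 → ℕ} (ha : ∀ i, a i < 16) :
    f (profileOf (sortedKey (List.ofFn a))) = f fun i => ballot (a i) := by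
  have hp := List.perm_insertionSort (· ≤ ·) (List.ofFn a)
  refine hf.apply_eq_of_perm ha ?_
  rw [← digits_eq_ofFn, sortedKey, digits_pack]
  · exact hp
  · rw [hp.length_eq, List.length_ofFn]
  · intro d hd
    rw [hp.mem_iff, List.mem_ofFn] at hd
    obtain ⟨i, rfl⟩ := hd
    exact ha i

/-- An encoded seat bound holds for a rule. -/
def BoundHolds (f : (Fin 6 → Finset (Fin 4)) → Multiset (Fin 4)) (l : ℕ) : Prop :=
  boundSeats l ≤ seats (f (profileOf (boundKey l))) (ballot (boundBallot l))

theorem sortedKey_lt {l : List ℕ} (hl : l.length = 6) (h : ∀ d ∈ l, d < 16) :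
    sortedKey l < 16 ^ 6 := by
  have hp := List.perm_insertionSort (· ≤ ·) l
  have hlen := hp.length_eq.trans hl
  have hlt : ∀ d ∈ l.insertionSort (· ≤ ·), d < 16 := fun d hd => h d (hp.mem_iff.1 hd)
  rw [sortedKey]
  generalize l.insertionSort (· ≤ ·) = s at hlen hlt
  match s, hlen with
  | [a, b, c, d, e, g], _ =>
    simp only [List.mem_cons, List.not_mem_nil, or_false, forall_eq_or_imp, forall_eq] at hlt
    simp only [pack]
    lia

theorem boundSeats_lt (l : ℕ) : boundSeats l < 4 := Nat.mod_lt _ (by norm_num)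

theorem boundBallot_lt (l : ℕ) : boundBallot l < 16 := Nat.mod_lt _ (by norm_num)

theorem boundHolds_relabel {f : (Fin 6 → Finset (Fin 4)) → Multiset (Fin 4)}
    (hf : IsGoodRule f) {r : ℕ} {σ : Equiv.Perm (Fin 4)}
    (hσ : ∀ b < 16, ballot (nibble r b) = (ballot b).map σ.toEmbedding) (l : ℕ) :
    BoundHolds f (relabel r l) ↔ BoundHolds (relabeledRule σ f) l := by
  have hmap : (digits (boundKey l)).map (nibble r) =
      List.ofFn fun i : Fin 6 => nibble r (nibble (boundKey l) i) := by simp [digits]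
  have hkey : sortedKey ((digits (boundKey l)).map (nibble r)) < 16 ^ 6 :=
    sortedKey_lt (by simp [digits]) (by simp [nibble_lt])
  have hs := boundSeats_lt l
  have hn := nibble_lt r (boundBallot l)
  have e1 : boundKey (relabel r l) = sortedKey ((digits (boundKey l)).map (nibble r)) := by
    rw [boundKey, relabel]
    lia
  have e2 : boundBallot (relabel r l) = nibble r (boundBallot l) := by
    rw [boundBallot, relabel]
    lia
  have e3 : boundSeats (relabel r l) = boundSeats l := by
    rw [boundSeats, relabel]
    lia
  rw [BoundHolds, BoundHolds, e1, e2, e3, hmap,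
    profileOf_sortedKey_apply hf.2.1 (fun _ => nibble_lt _ _), seats_relabeledRule,
    hσ _ (boundBallot_lt l)]
  simp only [hσ _ (nibble_lt _ _), profileOf]

/-- A disjunction of seat bounds holds for all rules in question. -/
def FactHolds (C : List ℕ) : Prop := ∀ f, IsGoodRule f → ∃ l ∈ C, BoundHolds f l

/-- `outcome` chooses for each key the number of the committee selected by `f`. -/
def IsOutcome (f : (Fin 6 → Finset (Fin 4)) → Multiset (Fin 4)) (outcome : ℕ → ℕ) : Prop :=
  ∀ key, outcome key < 20 ∧
    ∀ X, seats (f (profileOf key)) X = ∑ x ∈ X, committeeCount (outcome key) x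

theorem IsGoodRule.exists_isOutcome {f : (Fin 6 → Finset (Fin 4)) → Multiset (Fin 4)}
    (hf : IsGoodRule f) : ∃ outcome, IsOutcome f outcome := by
  choose outcome hlt hcount using fun key =>
    exists_committeeCount_eq _ (hf.1 _ (validProfile_profileOf key))
  exact ⟨outcome, fun key => ⟨hlt key, fun X => by simp [seats, hcount]⟩⟩

section

variable {f : (Fin 6 → Finset (Fin 4)) → Multiset (Fin 4)} {outcome : ℕ → ℕ}

theorem IsOutcome.testBit_thresholdMask (ho : IsOutcome f outcome) {b j : ℕ} (hb : b < 16)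
    (hj : j < 4) (key : ℕ) :
    (thresholdMask b j).testBit (outcome key) = true ↔
      j ≤ seats (f (profileOf key)) (ballot b) := by
  rw [_root_.testBit_thresholdMask b hb j hj _ (ho key).1, (ho key).2, decide_eq_true_iff,
    committeeSeats]

theorem IsOutcome.testBit_fullMask_xor (ho : IsOutcome f outcome) (m key : ℕ) :
    (fullMask ^^^ m).testBit (outcome key) = true ↔ ¬ m.testBit (outcome key) = true := by
  simp [testBit_fullMask _ (ho key).1]

theorem IsOutcome.testBit_boundMask (ho : IsOutcome f outcome) (l : ℕ) :
    (boundMask l).testBit (outcome (boundKey l)) = true ↔ BoundHolds f l :=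
  ho.testBit_thresholdMask (boundBallot_lt l) (boundSeats_lt l) _

theorem one_le_seats_of_two_le_countP (hf : IsGoodRule f) {key b : ℕ} {x : Fin 4}
    (hb : ballot b = {x}) (h : 2 ≤ (digits key).countP fun d => Nat.beq d b) :
    1 ≤ seats (f (profileOf key)) (ballot b) := by
  have hcount := hf.2.2.1 _ (validProfile_profileOf key) x
    (Finset.univ.filter fun i : Fin 6 => nibble key i = b) ?_ fun i hi => ?_
  · simpa [hb, seats] using hcount
  · have hcard : (Finset.univ.filter fun i : Fin 6 => nibble key i = b).card =
        (digits key).countP fun d => Nat.beq d b := by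
      rw [Finset.card_filter, Fin.sum_univ_six]
      simp only [digits, List.countP_cons, List.countP_nil, Nat.beq_eq, zero_add]
      simp only [Fin.coe_ofNat_eq_mod]
      lia
    lia
  · rw [profileOf, (Finset.mem_filter.1 hi).2, hb]

theorem testBit_representationMask (hf : IsGoodRule f) (ho : IsOutcome f outcome) (key : ℕ) :
    (representationMask key).testBit (outcome key) = true := by
  have h1 : ballot 1 = {0} := by decide +kernel
  have h2 : ballot 2 = {1} := by decide +kernel
  have h4 : ballot 4 = {2} := by decide +kernel
  have h8 : ballot 8 = {3} := by decide +kernel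
  have step : ∀ (b m : ℕ) (x : Fin 4), b < 16 → ballot b = {x} →
      m.testBit (outcome key) = true →
      (bif Nat.ble 2 ((digits key).countP fun d => Nat.beq d b) then
        thresholdMask b 1 &&& m else m).testBit (outcome key) = true := by
    intro b m x hb hx hm
    cases h : Nat.ble 2 ((digits key).countP fun d => Nat.beq d b)
    · exact hm
    · rw [cond_true, Nat.testBit_and, hm, Bool.and_true,
        ho.testBit_thresholdMask hb (by norm_num)]
      exact one_le_seats_of_two_le_countP hf hx (Nat.le_of_ble_eq_true h)
  exact step 1 _ _ (by norm_num) h1 <| step 2 _ _ (by norm_num) h2 <|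
    step 4 _ _ (by norm_num) h4 <| step 8 _ _ (by norm_num) h8 <| testBit_fullMask _ (ho key).1

/-- All masks in a list contain the committees selected by the rule. -/
def IsCorrect (outcome : ℕ → ℕ) (env : List (ℕ × ℕ)) : Prop :=
  ∀ p ∈ env, p.2.testBit (outcome p.1) = true

theorem IsCorrect.testBit_lookup (hf : IsGoodRule f) (ho : IsOutcome f outcome)
    {env : List (ℕ × ℕ)} (henv : IsCorrect outcome env) (key : ℕ) :
    (lookup key env).testBit (outcome key) = true := by
  induction env with
  | nil => exact testBit_representationMask hf ho key
  | cons p env ih =>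
    rw [lookup]
    cases h : Nat.beq p.1 key
    · exact ih fun q hq => henv q (List.mem_cons_of_mem _ hq)
    · rw [← Nat.eq_of_beq_eq_true h]
      exact henv p List.mem_cons_self

theorem false_of_restrict (hf : IsGoodRule f) (ho : IsOutcome f outcome) {key mask : ℕ}
    {env : List (ℕ × ℕ)} {cont : List (ℕ × ℕ) → Bool} (henv : IsCorrect outcome env)
    (hmask : mask.testBit (outcome key) = true)
    (hcont : ∀ env, IsCorrect outcome env → cont env = true → False)
    (h : restrict key mask env cont = true) : False := by
  have hbit : (lookup key env &&& mask).testBit (outcome key) = true := by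
    rw [Nat.testBit_and, henv.testBit_lookup hf ho, hmask, Bool.and_self]
  simp only [restrict, force_eq] at h
  cases h0 : Nat.beq (lookup key env &&& mask) 0
  · rw [h0, cond_false] at h
    refine hcont _ (fun p hp => ?_) h
    rcases List.mem_cons.1 hp with rfl | hp
    · exact hbit
    · exact henv p hp
  · rw [Nat.eq_of_beq_eq_true h0, Nat.zero_testBit] at hbit
    exact Bool.false_ne_true hbit

theorem false_of_assumeFailure (hf : IsGoodRule f) (ho : IsOutcome f outcome) {C : List ℕ}
    {env : List (ℕ × ℕ)} {cont : List (ℕ × ℕ) → Bool} (henv : IsCorrect outcome env)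
    (hC : ∀ l ∈ C, ¬ BoundHolds f l)
    (hcont : ∀ env, IsCorrect outcome env → cont env = true → False)
    (h : assumeFailure C env cont = true) : False := by
  induction C generalizing env with
  | nil => exact hcont env henv h
  | cons l C ih =>
    refine false_of_restrict hf ho henv ?_ (fun env henv h => ?_) h
    · rw [ho.testBit_fullMask_xor, ho.testBit_boundMask]
      exact hC l List.mem_cons_self
    · exact ih henv (fun l hl => hC l (List.mem_cons_of_mem _ hl)) h

theorem testBit_moveMask (ho : IsOutcome f outcome) {key key' a b m : ℕ} (ha : a < 16)
    (hb : b < 16)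
    (hincr : seats (f (profileOf key)) (ballot b) ≤ seats (f (profileOf key')) (ballot b))
    (hdecr : seats (f (profileOf key')) (ballot a) ≤ seats (f (profileOf key)) (ballot a))
    (hm : m.testBit (outcome key) = true) :
    (moveMask a b m).testBit (outcome key') = true := by
  have step : ∀ j acc, j < 4 → acc.testBit (outcome key') = true →
      ((bif Nat.beq (m &&& thresholdMask b j) m then thresholdMask b j else fullMask) &&&
        ((bif Nat.beq (m &&& thresholdMask a j) 0 then fullMask ^^^ thresholdMask a j
          else fullMask) &&& acc)).testBit (outcome key') = true := by
    intro j acc hj hacc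
    rw [Nat.testBit_and, Nat.testBit_and, hacc, Bool.and_true, Bool.and_eq_true]
    constructor
    · cases h : Nat.beq (m &&& thresholdMask b j) m
      · exact testBit_fullMask _ (ho key').1
      · rw [cond_true, ho.testBit_thresholdMask hb hj]
        refine le_trans ?_ hincr
        rw [← ho.testBit_thresholdMask hb hj]
        rw [← Nat.eq_of_beq_eq_true h, Nat.testBit_and, Bool.and_eq_true] at hm
        exact hm.2
    · cases h : Nat.beq (m &&& thresholdMask a j) 0
      · exact testBit_fullMask _ (ho key').1
      · rw [cond_true, ho.testBit_fullMask_xor, ho.testBit_thresholdMask ha hj]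
        intro hle
        have hbit := (ho.testBit_thresholdMask ha hj key).2 (hle.trans hdecr)
        have hand : (m &&& thresholdMask a j).testBit (outcome key) = true := by
          rw [Nat.testBit_and, hm, hbit, Bool.and_self]
        rw [Nat.eq_of_beq_eq_true h, Nat.zero_testBit] at hand
        exact Bool.false_ne_true hand
  exact step 1 _ (by norm_num) <| step 2 _ (by norm_num) <| step 3 _ (by norm_num) <|
    testBit_fullMask _ (ho key').1

theorem digits_set (key i b : ℕ) (hi : i < 6) :
    (digits key).set i b =
      List.ofFn (Function.update (fun i : Fin 6 => nibble key i) ⟨i, hi⟩ b) := by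
  interval_cases i <;> rfl

theorem false_of_moveStep (hf : IsGoodRule f) (ho : IsOutcome f outcome) {n : ℕ}
    {env : List (ℕ × ℕ)} {cont : List (ℕ × ℕ) → Bool} (henv : IsCorrect outcome env)
    (hcont : ∀ env, IsCorrect outcome env → cont env = true → False)
    (h : moveStep n env cont = true) : False := by
  rw [moveStep] at h
  split at h
  · exact Bool.false_ne_true h
  rename_i key m hget
  have hi : n % 6 < 6 := Nat.mod_lt _ (by norm_num)
  have hb : n / 6 % 16 < 16 := Nat.mod_lt _ (by norm_num)
  generalize n % 6 = i at h hi
  generalize n / 6 % 16 = b at h hb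
  have hupd : ∀ j, Function.update (fun j : Fin 6 => nibble key j) ⟨i, hi⟩ b j < 16 := by
    intro j
    by_cases hj : j = ⟨i, hi⟩
    · subst hj
      simpa using hb
    · simpa [hj] using nibble_lt _ _
  have hvalid : ValidProfile 6 fun j =>
      ballot (Function.update (fun j : Fin 6 => nibble key j) ⟨i, hi⟩ b j) :=
    fun j => ballot_nonempty _ (hupd j)
  have heq := profileOf_sortedKey_apply hf.2.1 hupd
  rw [← digits_set] at heq
  refine false_of_restrict hf ho henv (testBit_moveMask ho (nibble_lt _ _) hb ?_ ?_
    (henv _ (List.mem_of_getElem? hget))) hcont h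
  · rw [heq]
    have hle := hf.2.2.2 _ _ hvalid (validProfile_profileOf key) ⟨i, hi⟩
      fun j hj => by simp [hj, profileOf]
    simpa using hle
  · rw [heq]
    exact hf.2.2.2 _ _ (validProfile_profileOf key) hvalid ⟨i, hi⟩
      fun j hj => by simp [hj, profileOf]

theorem false_of_citeStep (hf : IsGoodRule f) (ho : IsOutcome f outcome) {db : List (List ℕ)}
    {n : ℕ} {env : List (ℕ × ℕ)} {cont : List (ℕ × ℕ) → Bool}
    (hdb : ∀ C ∈ db, FactHolds C) (henv : IsCorrect outcome env)
    (hcont : ∀ env, IsCorrect outcome env → cont env = true → False)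
    (h : citeStep db n env cont = true) : False := by
  rw [citeStep] at h
  split at h
  swap
  · exact Bool.false_ne_true h
  rename_i r C hr hC
  split at h
  · exact Bool.false_ne_true h
  rename_i l hl
  simp only [force_eq, Bool.and_eq_true, List.all_eq_true] at h
  obtain ⟨hrest, h⟩ := h
  obtain ⟨σ, hσ⟩ := exists_perm_of_mem_relabelings r (List.mem_of_getElem? hr)
  obtain ⟨l', hl', hholds⟩ := hdb C (List.mem_of_getElem? hC) _ (hf.relabeledRule σ)
  rw [← boundHolds_relabel hf hσ, ← ho.testBit_boundMask] at hholds
  have hll : l' = l := by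
    by_contra hne
    have hmem : l' ∈ C.eraseIdx (n / 32 % 64) := by
      obtain ⟨i, hi⟩ := List.mem_iff_getElem?.1 hl'
      refine List.mem_eraseIdx_iff_getElem?.2 ⟨i, fun hi' => hne ?_, hi⟩
      rw [hi', hl] at hi
      exact (Option.some.inj hi).symm
    have hzero := Nat.eq_of_beq_eq_true (hrest l' hmem)
    have hbit : (lookup (boundKey (relabel r l')) env &&& boundMask (relabel r l')).testBit
        (outcome (boundKey (relabel r l'))) = true := by
      rw [Nat.testBit_and, henv.testBit_lookup hf ho, hholds, Bool.and_self]
    rw [hzero, Nat.zero_testBit] at hbit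
    exact Bool.false_ne_true hbit
  subst hll
  exact false_of_restrict hf ho henv hholds hcont h

theorem false_of_propagate (hf : IsGoodRule f) (ho : IsOutcome f outcome) {db : List (List ℕ)}
    {ns : List ℕ} {env : List (ℕ × ℕ)} (hdb : ∀ C ∈ db, FactHolds C)
    (henv : IsCorrect outcome env) (h : propagate db ns env = true) : False := by
  induction ns generalizing env with
  | nil => exact Bool.false_ne_true h
  | cons n ns ih =>
    rw [propagate] at h
    cases h0 : Nat.beq (n % 2) 0 <;> rw [h0] at h
    · exact false_of_citeStep hf ho hdb henv (fun env henv h => ih henv h) h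
    · exact false_of_moveStep hf ho henv (fun env henv h => ih henv h) h

end

theorem factHolds_nil_of_checkCertificate {L : List (List ℕ × List ℕ)} {db : List (List ℕ)}
    (hdb : ∀ C ∈ db, FactHolds C) (h : checkCertificate L db = true) : FactHolds [] := by
  induction L generalizing db with
  | nil =>
    match db, h with
    | [] :: _, _ => exact hdb [] List.mem_cons_self
  | cons p L ih =>
    rw [checkCertificate, Bool.and_eq_true] at h
    refine ih (fun C hC => ?_) h.2
    rcases List.mem_cons.1 hC with rfl | hC
    · intro f hf
      obtain ⟨outcome, ho⟩ := hf.exists_isOutcome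
      by_contra! hnot
      exact false_of_assumeFailure hf ho (fun p hp => absurd hp List.not_mem_nil) hnot
        (fun env henv h => false_of_propagate hf ho hdb henv h) h.1
    · exact hdb C hC

/-- There is no party-approval rule for 6 voters, 4 parties, and
committee size 3 that satisfies anonymity, weak representation, and strategyproofness. -/
theorem no_anonymous_weakRep_strategyproof_rule_6_4_3 :
    ¬ ∃ f : (Fin 6 → Finset (Fin 4)) → Multiset (Fin 4),
        IsPAPPRule 6 3 f ∧ Anonymous 6 f ∧ WeakRep 6 3 f ∧ Strategyproof 6 f := by
  rintro ⟨f, hf⟩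
  obtain ⟨l, hl, -⟩ := factHolds_nil_of_checkCertificate
    (fun C hC => absurd hC List.not_mem_nil) checkCertificate_certificate f hf
  exact List.not_mem_nil hl
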